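/- For all positive integers k, r, and c, there exists an integer N such that every finite set A of at least N lines in the plane ℝ², with the property that no point of ℝ² lies on more than r distinct lines of A, contains pairwise disjoint subsets A₁, …, A_k ⊆ A with |A_i| ≥ c for each i, such that for every choice of points x₁, …, x_k with x_i ∈ conv(V(A_i)) for each i, the points x₁, …, x_k are in convex position. -/

import Mathlib

open RealInnerProductSpace

/-- A line in ℝ²: a 1-dimensional affine subspace, i.e. a set of the form
`{p + t • v : t ∈ ℝ}` with `v ≠ 0`. -/
def IsLine (L : Set (EuclideanSpace ℝ (Fin 2))) : Prop :=
  ∃ p v : EuclideanSpace ℝ (Fin 2), v ≠ 0 ∧ L = {x | ∃ t : ℝ, x = p + t • v}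

/-- The vertex set of a finite arrangement `A` of lines in ℝ²:
points lying on at least 2 distinct lines of `A`. -/
def verts (A : Finset (Set (EuclideanSpace ℝ (Fin 2)))) :
    Set (EuclideanSpace ℝ (Fin 2)) :=
  {x | ∃ B ⊆ A, 2 ≤ B.card ∧ ∀ L ∈ B, x ∈ L}

open Finset in
/-- **Ramsey's theorem** for finite colourings of the `d`-element subsets of a finite set. -/
theorem exists_ramsey_number {α κ : Type*} [LinearOrder α] [Fintype κ] (d m : ℕ) :
    ∃ N : ℕ, ∀ S : Finset α, N ≤ #S → ∀ χ : Finset α → κ,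
      ∃ T ⊆ S, m ≤ #T ∧ ∃ z, ∀ U ⊆ T, #U = d → χ U = z := by
  classical
  induction d generalizing m with
  | zero =>
    refine ⟨m, fun S hS χ => ⟨S, subset_rfl, hS, χ ∅, fun U _ hU => ?_⟩⟩
    rw [card_eq_zero.1 hU]
  | succ d ih =>
    have minColored (n : ℕ) : ∃ N : ℕ, ∀ S : Finset α, N ≤ #S → ∀ χ : Finset α → κ,
        ∃ T ⊆ S, n ≤ #T ∧ ∃ z : α → κ, ∀ U ⊆ T, #U = d + 1 →
          ∀ a ∈ U, (∀ b ∈ U, a ≤ b) → χ U = z a := by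
      induction n with
      | zero =>
        refine ⟨0, fun S _ χ => ⟨∅, empty_subset _, le_rfl, fun _ => χ ∅, fun U hU hc => ?_⟩⟩
        rw [subset_empty.1 hU] at hc
        simp at hc
      | succ n ihn =>
        obtain ⟨N₁, hN₁⟩ := ihn
        obtain ⟨N₂, hN₂⟩ := ih N₁
        refine ⟨N₂ + 1, fun S hS χ => ?_⟩
        have hne : S.Nonempty := card_pos.1 (by omega)
        set a := S.min' hne
        have haS : a ∈ S := S.min'_mem hne
        obtain ⟨S', hS', hcS', w, hw⟩ := hN₂ (S.erase a) (by rw [card_erase_of_mem haS]; omega)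
          (fun U => χ (insert a U))
        obtain ⟨T, hT, hcT, z, hz⟩ := hN₁ S' hcS' χ
        have haT : a ∉ T := fun h => notMem_erase a S (hS' (hT h))
        have hTS : T ⊆ S := (hT.trans hS').trans (erase_subset _ _)
        refine ⟨insert a T, insert_subset haS hTS, by rw [card_insert_of_notMem haT]; omega,
          fun b => if b = a then w else z b, fun U hU hcU b hb hmin => ?_⟩
        by_cases haU : a ∈ U
        · have hba : b = a := le_antisymm (hmin a haU) <| S.min'_le b <|
            insert_subset haS hTS (hU hb)
          simp only [if_pos hba]
          rw [← hw (U.erase a) ((subset_insert_iff.1 hU).trans hT)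
            (by rw [card_erase_of_mem haU]; omega), insert_erase haU]
        · have hba : b ≠ a := fun h => haU (h ▸ hb)
          simp only [if_neg hba]
          exact hz U ((subset_insert_iff_of_notMem haU).1 hU) hcU b hb hmin
    obtain ⟨N, hN⟩ := minColored (Fintype.card κ * m + 1)
    refine ⟨N, fun S hS χ => ?_⟩
    obtain ⟨T, hT, hcT, z, hz⟩ := hN S hS χ
    obtain ⟨w, -, hw⟩ := exists_lt_card_fiber_of_mul_lt_card_of_maps_to (s := T)
      (t := (univ : Finset κ)) (f := z) (n := m) (fun _ _ => mem_univ _)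
      (by rw [card_univ]; omega)
    refine ⟨T.filter (z · = w), (filter_subset _ _).trans hT, hw.le, w, fun U hU hcU => ?_⟩
    have hne : U.Nonempty := card_pos.1 (by omega)
    rw [hz U (hU.trans (filter_subset _ _)) hcU (U.min' hne) (U.min'_mem hne)
      (fun b hb => U.min'_le b hb)]
    exact (mem_filter.1 (hU (U.min'_mem hne))).2

open Finset in
theorem exists_consecutive_blocks {α : Type*} [LinearOrder α] {k c : ℕ} {T : Finset α}
    (hT : k * c ≤ #T) :
    ∃ S : Fin k → Finset α, (∀ i, S i ⊆ T) ∧ (∀ i, #(S i) = c) ∧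
      ∀ i j, i < j → ∀ a ∈ S i, ∀ b ∈ S j, a < b := by
  obtain ⟨T', hT', hcT'⟩ := exists_subset_card_eq hT
  let f : Fin (k * c) ↪o α := T'.orderEmbOfFin hcT'
  refine ⟨fun i => univ.image fun j : Fin c => f (finProdFinEquiv (i, j)), fun i a ha => ?_,
    fun i => ?_, fun i j hij a ha b hb => ?_⟩
  · obtain ⟨j, -, rfl⟩ := mem_image.1 ha
    exact hT' (T'.orderEmbOfFin_mem hcT' _)
  · rw [card_image_of_injective, card_univ, Fintype.card_fin]
    intro j j' h
    simpa using h
  · obtain ⟨u, -, rfl⟩ := mem_image.1 ha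
    obtain ⟨v, -, rfl⟩ := mem_image.1 hb
    rw [f.lt_iff_lt, Fin.lt_def, finProdFinEquiv_apply_val, finProdFinEquiv_apply_val]
    have h : (i : ℕ) + 1 ≤ j := hij
    have := Nat.mul_le_mul_left c h
    have hu : (u : ℕ) < c := u.2
    simp only
    rw [mul_add] at this
    omega

open Finset in
theorem exists_disjoint_blocks {α : Type*} {k c : ℕ} {T : Finset α} (hT : k * c ≤ #T) :
    ∃ S : Fin k → Finset α, (∀ i, S i ⊆ T) ∧ (∀ i, #(S i) = c) ∧
      ∀ i j, i ≠ j → Disjoint (S i) (S j) := by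
  classical
  let _ : LinearOrder α := linearOrderOfSTO WellOrderingRel
  obtain ⟨S, hS, hc, hlt⟩ := exists_consecutive_blocks hT
  refine ⟨S, hS, hc, fun i j hij => disjoint_left.2 fun a hi hj => ?_⟩
  rcases hij.lt_or_gt with h | h
  · exact (hlt i j h a hi a hj).false
  · exact (hlt j i h a hj a hi).false

theorem convex_setOf_mul_add_lt {E : Type*} [AddCommGroup E] [Module ℝ E] (X Y : E →ₗ[ℝ] ℝ)
    (d e : ℝ) : Convex ℝ {p | d * X p + e < Y p} := by
  convert convex_halfSpace_lt (𝕜 := ℝ) (d • X - Y).isLinear (-e) using 3 with p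
  simp only [LinearMap.sub_apply, LinearMap.smul_apply, smul_eq_mul]
  constructor <;> intro _ <;> linarith

/-- If through every point of `V` there is a line strictly below `l` and `r`, with `l` strictly to
the left of the point and `r` strictly to its right, then the convex hulls of `V` and `l ∪ r` are
disjoint. -/
theorem notMem_convexHull_union_of_forall_exists_slope {E : Type*} [AddCommGroup E] [Module ℝ E]
    (X Y : E →ₗ[ℝ] ℝ) {V l r : Set E}
    (h : ∀ q ∈ V, ∃ d : ℝ, (∀ p ∈ l, X p < X q ∧ d * (X p - X q) < Y p - Y q) ∧
      ∀ p ∈ r, X q < X p ∧ d * (X p - X q) < Y p - Y q)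
    {Q : E} (hQ : Q ∈ convexHull ℝ V) : Q ∉ convexHull ℝ (l ∪ r) := by
  have above (d : ℝ) (q : E) : Convex ℝ {p | d * (X p - X q) < Y p - Y q} := by
    convert convex_setOf_mul_add_lt X Y d (Y q - d * X q) using 3 with p
    constructor <;> intro _ <;> linarith
  have hull : ∀ q ∈ V, ∃ d : ℝ,
      (∀ p ∈ convexHull ℝ l, X p < X q ∧ d * (X p - X q) < Y p - Y q) ∧
      ∀ p ∈ convexHull ℝ r, X q < X p ∧ d * (X p - X q) < Y p - Y q := by
    intro q hq
    obtain ⟨d, hl, hr⟩ := h q hq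
    exact ⟨d, convexHull_min hl ((convex_halfSpace_lt X.isLinear (X q)).inter (above d q)),
      convexHull_min hr ((convex_halfSpace_gt X.isLinear (X q)).inter (above d q))⟩
  have left : ∀ p ∈ convexHull ℝ l, X p < X Q := fun p hp =>
    convexHull_min (fun q hq => ((hull q hq).choose_spec.1 p hp).1)
      (convex_halfSpace_gt X.isLinear (X p)) hQ
  have right : ∀ p ∈ convexHull ℝ r, X Q < X p := fun p hp =>
    convexHull_min (fun q hq => ((hull q hq).choose_spec.2 p hp).1)
      (convex_halfSpace_lt X.isLinear (X p)) hQ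
  intro hmem
  rcases l.eq_empty_or_nonempty with rfl | hl
  · rw [Set.empty_union] at hmem
    exact (right Q hmem).false
  rcases r.eq_empty_or_nonempty with rfl | hr
  · rw [Set.union_empty] at hmem
    exact (left Q hmem).false
  rw [convexHull_union hl hr, mem_convexJoin] at hmem
  obtain ⟨P, hP, R, hR, s, t, hs, ht, hst, rfl⟩ := hmem
  let D : E →ₗ[ℝ] ℝ := (X R - X P) • Y - (Y R - Y P) • X
  have below : V ⊆ {q | D q < D P} := by
    intro q hq
    obtain ⟨d, hdl, hdr⟩ := hull q hq
    obtain ⟨h₁, h₂⟩ := hdl P hP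
    obtain ⟨h₃, h₄⟩ := hdr R hR
    simp only [D, Set.mem_ofPred_eq, LinearMap.sub_apply, LinearMap.smul_apply, smul_eq_mul]
    nlinarith [mul_lt_mul_of_pos_right h₂ (sub_pos.2 h₃),
      mul_lt_mul_of_pos_right h₄ (sub_pos.2 h₁)]
  have hlt : D (s • P + t • R) < D P := convexHull_min below (convex_halfSpace_lt D.isLinear _) hQ
  refine hlt.ne ?_
  simp only [D, map_add, map_smul, LinearMap.sub_apply, LinearMap.smul_apply, smul_eq_mul]
  obtain rfl : s = 1 - t := by linarith
  ring

theorem IsLine.vertical_or_graph {L : Set (EuclideanSpace ℝ (Fin 2))} (hL : IsLine L) :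
    (∃ b : ℝ, L = {x | x 0 = b}) ∨ ∃ m b : ℝ, L = {x | x 1 = m * x 0 + b} := by
  obtain ⟨p, v, hv, rfl⟩ := hL
  by_cases h0 : v 0 = 0
  · have h1 : v 1 ≠ 0 := fun h1 => hv (by ext i; fin_cases i <;> simp [h0, h1])
    refine .inl ⟨p 0, Set.ext fun x => ⟨?_, fun hx => ⟨(x 1 - p 1) / v 1, ?_⟩⟩⟩
    · rintro ⟨t, rfl⟩
      simp [h0]
    · ext i
      fin_cases i
      · simpa [h0] using hx
      · simp [h1]
  · refine .inr ⟨v 1 / v 0, p 1 - v 1 / v 0 * p 0,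
      Set.ext fun x => ⟨?_, fun hx => ⟨(x 0 - p 0) / v 0, ?_⟩⟩⟩
    · rintro ⟨t, rfl⟩
      simp only [Set.mem_ofPred_eq, PiLp.add_apply, PiLp.smul_apply, smul_eq_mul]
      field_simp
      ring
    · have hx' : x 1 = v 1 / v 0 * x 0 + (p 1 - v 1 / v 0 * p 0) := hx
      ext i
      fin_cases i
      · simp [h0]
      · simp only [Fin.mk_one, PiLp.add_apply, PiLp.smul_apply, smul_eq_mul, hx']
        field_simp
        ring

theorem verts_eq_empty_of_pairwise_parallel {A : Finset (Set (EuclideanSpace ℝ (Fin 2)))}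
    (hA : ∀ L ∈ A, ∀ L' ∈ A, ∀ x ∈ L, x ∈ L' → L = L') : verts A = ∅ := by
  refine Set.eq_empty_of_forall_notMem ?_
  rintro x ⟨B, hBA, hB, hx⟩
  obtain ⟨L, hL, L', hL', hne⟩ := Finset.one_lt_card.1 hB
  exact hne (hA L (hBA hL) L' (hBA hL') x (hx L hL) (hx L' hL'))

theorem exists_blocks_of_pairwise_parallel {k c : ℕ}
    {A A' : Finset (Set (EuclideanSpace ℝ (Fin 2)))} (hA' : A' ⊆ A) (hcard : k * c ≤ A'.card)
    (hpar : ∀ L ∈ A', ∀ L' ∈ A', ∀ x ∈ L, x ∈ L' → L = L') :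
    ∃ As : Fin k → Finset (Set (EuclideanSpace ℝ (Fin 2))),
      (∀ i, As i ⊆ A) ∧ (∀ i j, i ≠ j → Disjoint (As i) (As j)) ∧ (∀ i, c ≤ (As i).card) ∧
      ∀ x : Fin k → EuclideanSpace ℝ (Fin 2), (∀ i, x i ∈ convexHull ℝ (verts (As i))) →
        ∀ i, x i ∉ convexHull ℝ (x '' {j | j ≠ i}) := by
  obtain ⟨S, hS, hc, hdisj⟩ := exists_disjoint_blocks hcard
  refine ⟨S, fun i => (hS i).trans hA', hdisj, fun i => (hc i).ge, fun x hx i => ?_⟩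
  have hi := hx i
  rw [verts_eq_empty_of_pairwise_parallel fun L hL L' hL' => hpar L (hS i hL) L' (hS i hL'),
    convexHull_empty] at hi
  exact hi.elim

/-- The crossing point `(x, y)` of two lines of a concave family lies above every line of the
family whose slope is not between theirs. -/
theorem lt_of_concave_of_crossing {T : Finset ℝ} {β : ℝ → ℝ}
    (hβ : ∀ a ∈ T, ∀ b ∈ T, ∀ d ∈ T, a < b → b < d →
      (d - b) * β a + (b - a) * β d < (d - a) * β b)
    {a b d x y : ℝ} (ha : a ∈ T) (hb : b ∈ T) (hd : d ∈ T) (hab : a < b) (hya : y = a * x + β a)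
    (hyb : y = b * x + β b) (h : d < a ∨ b < d) : d * x + β d < y := by
  have ea : β a = y - a * x := by linarith
  have eb : β b = y - b * x := by linarith
  rcases h with h | h
  · have := hβ d hd a ha b hb h hab
    rw [ea, eb] at this
    nlinarith
  · have := hβ a ha b hb d hd hab h
    rw [ea, eb] at this
    nlinarith

/-- Consecutive blocks of an arrangement of lines `Y = a * X + β a` with slopes `a` in `T` and
strictly concave intercepts `β`. -/
theorem exists_blocks_of_concave {k c : ℕ} {T : Finset ℝ} (hcard : k * c ≤ T.card)
    (X Y : EuclideanSpace ℝ (Fin 2) →ₗ[ℝ] ℝ) {β : ℝ → ℝ}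
    (hβ : ∀ a ∈ T, ∀ b ∈ T, ∀ d ∈ T, a < b → b < d →
      (d - b) * β a + (b - a) * β d < (d - a) * β b)
    {A : Finset (Set (EuclideanSpace ℝ (Fin 2)))} {ℓ : ℝ → Set (EuclideanSpace ℝ (Fin 2))}
    (hA : ∀ a ∈ T, ℓ a ∈ A) (hinj : Set.InjOn ℓ T)
    (hℓ : ∀ a ∈ T, ∀ p ∈ ℓ a, Y p = a * X p + β a) :
    ∃ As : Fin k → Finset (Set (EuclideanSpace ℝ (Fin 2))),
      (∀ i, As i ⊆ A) ∧ (∀ i j, i ≠ j → Disjoint (As i) (As j)) ∧ (∀ i, c ≤ (As i).card) ∧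
      ∀ x : Fin k → EuclideanSpace ℝ (Fin 2), (∀ i, x i ∈ convexHull ℝ (verts (As i))) →
        ∀ i, x i ∉ convexHull ℝ (x '' {j | j ≠ i}) := by
  classical
  obtain ⟨S, hS, hc, hlt⟩ := exists_consecutive_blocks hcard
  have crossing : ∀ i, ∀ q ∈ verts ((S i).image ℓ), ∃ a ∈ S i, ∃ b ∈ S i, a < b ∧
      Y q = a * X q + β a ∧ Y q = b * X q + β b := by
    rintro i q ⟨B, hBA, hB, hq⟩
    obtain ⟨L, hL, L', hL', hne⟩ := Finset.one_lt_card.1 hB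
    obtain ⟨a, ha, rfl⟩ := Finset.mem_image.1 (hBA hL)
    obtain ⟨b, hb, rfl⟩ := Finset.mem_image.1 (hBA hL')
    have hqa := hℓ a (hS i ha) q (hq _ hL)
    have hqb := hℓ b (hS i hb) q (hq _ hL')
    rcases lt_trichotomy a b with h | rfl | h
    · exact ⟨a, ha, b, hb, h, hqa, hqb⟩
    · exact absurd rfl hne
    · exact ⟨b, hb, a, ha, h, hqb, hqa⟩
  have above_right : ∀ i j, i < j → ∀ q ∈ verts ((S i).image ℓ), ∀ d ∈ S j,
      d * X q + β d < Y q := by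
    intro i j hij q hq d hd
    obtain ⟨a, ha, b, hb, hab, hqa, hqb⟩ := crossing i q hq
    exact lt_of_concave_of_crossing hβ (hS i ha) (hS i hb) (hS j hd) hab hqa hqb
      (.inr (hlt i j hij b hb d hd))
  have above_left : ∀ i j, i < j → ∀ q ∈ verts ((S j).image ℓ), ∀ d ∈ S i,
      d * X q + β d < Y q := by
    intro i j hij q hq d hd
    obtain ⟨a, ha, b, hb, hab, hqa, hqb⟩ := crossing j q hq
    exact lt_of_concave_of_crossing hβ (hS j ha) (hS j hb) (hS i hd) hab hqa hqb
      (.inl (hlt i j hij d hd a ha))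
  have X_lt : ∀ i j, i < j → ∀ p ∈ verts ((S i).image ℓ), ∀ q ∈ verts ((S j).image ℓ),
      X p < X q := by
    intro i j hij p hp q hq
    obtain ⟨a, ha, -, -, -, hpa, -⟩ := crossing i p hp
    obtain ⟨d, hd, -, -, -, hqd, -⟩ := crossing j q hq
    have h₁ := above_right i j hij p hp d hd
    have h₂ := above_left i j hij q hq a ha
    have h₃ := hlt i j hij a ha d hd
    nlinarith
  refine ⟨fun i => (S i).image ℓ, fun i => ?_, fun i j hij => ?_, fun i => ?_, fun x hx i => ?_⟩
  · exact Finset.image_subset_iff.2 fun a ha => hA a (hS i ha)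
  · refine Finset.disjoint_left.2 fun L hL hL' => ?_
    obtain ⟨a, ha, rfl⟩ := Finset.mem_image.1 hL
    obtain ⟨b, hb, hab⟩ := Finset.mem_image.1 hL'
    obtain rfl := hinj (hS j hb) (hS i ha) hab
    rcases hij.lt_or_gt with h | h
    · exact (hlt i j h b ha b hb).false
    · exact (hlt j i h b hb b ha).false
  · rw [Finset.card_image_of_injOn (hinj.mono (hS i)), hc]
  · have hset : x '' {j | j ≠ i} = x '' Set.Iio i ∪ x '' Set.Ioi i := by
      rw [← Set.image_union, Set.Iio_union_Ioi]
      rfl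
    rw [hset]
    refine notMem_convexHull_union_of_forall_exists_slope X Y (fun q hq => ?_) (hx i)
    obtain ⟨d, hd, -, -, -, hqd, -⟩ := crossing i q hq
    have above := convex_setOf_mul_add_lt X Y d (β d)
    refine ⟨d, ?_, ?_⟩
    · rintro _ ⟨j, hj, rfl⟩
      have h₁ : X (x j) < X q := convexHull_min (fun p hp => X_lt j i hj p hp q hq)
        (convex_halfSpace_lt X.isLinear (X q)) (hx j)
      have h₂ : d * X (x j) + β d < Y (x j) :=
        convexHull_min (fun p hp => above_right j i hj p hp d hd) above (hx j)
      exact ⟨h₁, by linarith⟩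
    · rintro _ ⟨j, hj, rfl⟩
      have h₁ : X q < X (x j) := convexHull_min (fun p hp => X_lt i j hj q hq p hp)
        (convex_halfSpace_gt X.isLinear (X q)) (hx j)
      have h₂ : d * X (x j) + β d < Y (x j) :=
        convexHull_min (fun p hp => above_left i j hj p hp d hd) above (hx j)
      exact ⟨h₁, by linarith⟩

/-- The divided difference of `β` at the points of `U`. -/
noncomputable def dividedDifference (β : ℝ → ℝ) (U : Finset ℝ) : ℝ :=
  ∑ a ∈ U, β a / ∏ b ∈ U.erase a, (a - b)

theorem dividedDifference_triple (β : ℝ → ℝ) {a b d : ℝ} (hab : a < b) (hbd : b < d) :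
    dividedDifference β {a, b, d} * ((b - a) * (d - b) * (d - a)) =
      (d - b) * β a + (b - a) * β d - (d - a) * β b := by
  have had := hab.trans hbd
  have e₁ : ({a, b, d} : Finset ℝ).erase a = {b, d} := by ext; simp; grind
  have e₂ : ({a, b, d} : Finset ℝ).erase b = {a, d} := by ext; simp; grind
  have e₃ : ({a, b, d} : Finset ℝ).erase d = {a, b} := by ext; simp; grind
  rw [dividedDifference, Finset.sum_insert (by simp [hab.ne, had.ne]),
    Finset.sum_pair hbd.ne, e₁, e₂, e₃, Finset.prod_pair hbd.ne, Finset.prod_pair had.ne,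
    Finset.prod_pair hab.ne]
  have h₁ : a - b ≠ 0 := (sub_neg.2 hab).ne
  have h₂ : b - d ≠ 0 := (sub_neg.2 hbd).ne
  have h₃ : a - d ≠ 0 := (sub_neg.2 had).ne
  have h₄ : b - a ≠ 0 := (sub_pos.2 hab).ne'
  have h₅ : d - b ≠ 0 := (sub_pos.2 hbd).ne'
  have h₆ : d - a ≠ 0 := (sub_pos.2 had).ne'
  field_simp
  ring

theorem exists_mem_forall_of_dividedDifference_eq_zero {T : Finset ℝ} {β : ℝ → ℝ}
    (hcard : 2 ≤ T.card)
    (h : ∀ a ∈ T, ∀ b ∈ T, ∀ d ∈ T, a < b → b < d →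
      (d - b) * β a + (b - a) * β d - (d - a) * β b = 0) :
    ∃ x y : ℝ, ∀ d ∈ T, y = d * x + β d := by
  obtain ⟨a, ha, b, hb, hne⟩ := Finset.one_lt_card.1 hcard
  wlog hab : a < b generalizing a b
  · exact this b hb a ha hne.symm (hne.symm.lt_of_le (not_lt.1 hab))
  have hba : b - a ≠ 0 := (sub_pos.2 hab).ne'
  refine ⟨-(β b - β a) / (b - a), a * (-(β b - β a) / (b - a)) + β a, fun d hd => ?_⟩
  have key : (d - b) * β a + (b - a) * β d - (d - a) * β b = 0 := by
    rcases lt_trichotomy d a with hda | rfl | hda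
    · linarith [h d hd a ha b hb hda hab]
    · ring
    rcases lt_trichotomy d b with hdb | rfl | hdb
    · linarith [h a ha d hd b hb hda hdb]
    · ring
    · exact h a ha b hb d hd hab hdb
  field_simp
  linarith

/-- Positive portion Erdős–Szekeres theorem for line arrangements: for all positive
`k, r, c` there is `N` such that any arrangement of at least `N` lines with no point
on more than `r` lines contains `k` disjoint subsets of at least `c` lines each,
such that every transversal of the convex hulls of their vertex sets is in convex
position. -/
theorem erdos_szekeres_line_arrangements (k r c : ℕ) (hk : 0 < k) (hr : 0 < r) (hc : 0 < c) :
    ∃ N : ℕ, ∀ A : Finset (Set (EuclideanSpace ℝ (Fin 2))),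
      (∀ L ∈ A, IsLine L) → N ≤ A.card →
      (∀ (x : EuclideanSpace ℝ (Fin 2)) (B : Finset (Set (EuclideanSpace ℝ (Fin 2)))),
        B ⊆ A → (∀ L ∈ B, x ∈ L) → B.card ≤ r) →
      ∃ As : Fin k → Finset (Set (EuclideanSpace ℝ (Fin 2))),
        (∀ i, As i ⊆ A) ∧
        (∀ i j, i ≠ j → Disjoint (As i) (As j)) ∧
        (∀ i, c ≤ (As i).card) ∧
        ∀ x : Fin k → EuclideanSpace ℝ (Fin 2),
          (∀ i, x i ∈ convexHull ℝ (verts (As i))) →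
          ∀ i, x i ∉ convexHull ℝ (x '' {j | j ≠ i}) := by
  classical
  obtain ⟨M, hM⟩ := exists_ramsey_number (α := ℝ) (κ := SignType) 3 (k * c + r + 1)
  refine ⟨k * c + k * c * M, fun A hA hN hr' => ?_⟩
  let V := A.filter fun L => ∃ b : ℝ, L = {x | x 0 = b}
  by_cases hvert : k * c ≤ V.card
  · refine exists_blocks_of_pairwise_parallel (Finset.filter_subset _ _) hvert ?_
    simp only [Finset.mem_filter]
    rintro L ⟨-, b, rfl⟩ L' ⟨-, b', rfl⟩ x rfl rfl
    rfl
  let G := A \ V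
  have hG : k * c * M ≤ G.card := by
    have : A.card - V.card ≤ G.card := Finset.le_card_sdiff V A
    omega
  have hGA : G ⊆ A := Finset.sdiff_subset
  have graph : ∀ L ∈ G, ∃ m b : ℝ, L = {x | x 1 = m * x 0 + b} := fun L hL =>
    (hA L (hGA hL)).vertical_or_graph.resolve_left fun h =>
      (Finset.mem_sdiff.1 hL).2 (Finset.mem_filter.2 ⟨hGA hL, h⟩)
  choose! m b hmb using graph
  by_cases hfib : ∃ t, k * c ≤ (G.filter (m · = t)).card
  · obtain ⟨t, ht⟩ := hfib
    refine exists_blocks_of_pairwise_parallel ((Finset.filter_subset _ _).trans hGA) ht ?_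
    simp only [Finset.mem_filter]
    rintro L ⟨hL, hmL⟩ L' ⟨hL', hmL'⟩ x hx hx'
    rw [hmb L hL, hmL] at hx ⊢
    rw [hmb L' hL', hmL'] at hx' ⊢
    simp only [Set.mem_ofPred_eq] at hx hx'
    have : b L = b L' := by linarith
    rw [this]
  push Not at hfib
  have himage : M ≤ (G.image m).card := by
    have hpos : 0 < k * c := by positivity
    have := Finset.card_le_mul_card_image (f := m) G (k * c) fun t _ => (hfib t).le
    exact le_of_mul_le_mul_left (hG.trans this) hpos
  have rep : ∀ t ∈ G.image m, ∃ L ∈ G, m L = t := fun t ht => Finset.mem_image.1 ht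
  choose! ℓ hℓG hℓm using rep
  obtain ⟨T, hT, hcT, z, hz⟩ := hM _ himage
    (fun U => SignType.sign (dividedDifference (fun t => b (ℓ t)) U))
  have hinj : Set.InjOn ℓ T := fun s hs t ht hst => by
    rw [← hℓm s (hT hs), ← hℓm t (hT ht), hst]
  have hℓA : ∀ a ∈ T, ℓ a ∈ A := fun a ha => hGA (hℓG a (hT ha))
  have hℓ : ∀ a ∈ T, ∀ p, p ∈ ℓ a ↔ p 1 = a * p 0 + b (ℓ a) := fun a ha p => by
    conv_lhs => rw [hmb (ℓ a) (hℓG a (hT ha)), hℓm a (hT ha)]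
    rfl
  have sign_eq : ∀ a ∈ T, ∀ u ∈ T, ∀ d ∈ T, a < u → u < d →
      SignType.sign ((d - u) * b (ℓ a) + (u - a) * b (ℓ d) - (d - a) * b (ℓ u)) = z := by
    intro a ha u hu d hd hau hud
    have hpos : 0 < (u - a) * (d - u) * (d - a) :=
      mul_pos (mul_pos (sub_pos.2 hau) (sub_pos.2 hud)) (sub_pos.2 (hau.trans hud))
    rw [← dividedDifference_triple (fun t => b (ℓ t)) hau hud, sign_mul, sign_pos hpos, mul_one]
    refine hz _ ?_ (Finset.card_eq_three.2 ⟨a, u, d, hau.ne, (hau.trans hud).ne, hud.ne, rfl⟩)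
    simp [Finset.insert_subset_iff, ha, hu, hd]
  let X : EuclideanSpace ℝ (Fin 2) →ₗ[ℝ] ℝ := (EuclideanSpace.proj 0).toLinearMap
  let Y : EuclideanSpace ℝ (Fin 2) →ₗ[ℝ] ℝ := (EuclideanSpace.proj 1).toLinearMap
  cases z with
  | zero =>
    obtain ⟨x, y, hxy⟩ := exists_mem_forall_of_dividedDifference_eq_zero (T := T)
      (β := fun t => b (ℓ t)) (by omega) fun a ha u hu d hd hau hud =>
        sign_eq_zero_iff.1 (sign_eq a ha u hu d hd hau hud)
    have := hr' !₂[x, y] (T.image ℓ) (Finset.image_subset_iff.2 hℓA) (by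
      intro L hL
      obtain ⟨d, hd, rfl⟩ := Finset.mem_image.1 hL
      rw [hℓ d hd]
      simpa using hxy d hd)
    rw [Finset.card_image_of_injOn hinj] at this
    omega
  | neg =>
    refine exists_blocks_of_concave (T := T) (by omega) X Y (β := fun t => b (ℓ t))
      (fun a ha u hu d hd hau hud => ?_) hℓA hinj fun a ha p hp => (hℓ a ha p).1 hp
    exact sub_neg.1 (sign_eq_neg_one_iff.1 (sign_eq a ha u hu d hd hau hud))
  | pos =>
    refine exists_blocks_of_concave (T := T) (by omega) (-X) (-Y) (β := fun t => -b (ℓ t))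
      (fun a ha u hu d hd hau hud => ?_) hℓA hinj fun a ha p hp => ?_
    · have := sign_eq_one_iff.1 (sign_eq a ha u hu d hd hau hud)
      linarith
    · have h : Y p = a * X p + b (ℓ a) := (hℓ a ha p).1 hp
      rw [LinearMap.neg_apply, LinearMap.neg_apply, h]
      ring
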